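/- Let X be a type, U a nonempty finite type, f : ℕ → X → U → X the dynamics, ℓ_t, g_t : X → ℝ margin functions, and T a finite horizon. Then there exists a feedback policy π : ℕ → X → U that is strongly time-consistent for the reach-avoid problem: for every s ≤ T, every state x̃ ∈ X, and every alternative control sequence u_s,…,u_{T−1} ∈ U, the closed-loop trajectory from (s, x̃) under π satisfies J_s(x^π_{s,x̃}) ≤ J_s(x^u_{s,x̃}), where J_s(x) = min_{t∈{s,…,T}} max{ℓ_t(x_t), max_{τ∈{s,…,t}} g_τ(x_τ)}. -/

import Mathlib

/-- Reach-avoid objective-to-go: J_s = min_{t∈{s,…,T}} max{a_t, max_{τ∈{s,…,t}} b_τ}. -/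
noncomputable def raJ (T : ℕ) (a b : ℕ → ℝ) (s : ℕ) (hs : s ≤ T) : ℝ :=
  (Finset.Icc s T).attach.inf'
    (Finset.attach_nonempty_iff.mpr (Finset.nonempty_Icc.mpr hs))
    fun t => max (a t.1)
      ((Finset.Icc s t.1).sup' (Finset.nonempty_Icc.mpr (Finset.mem_Icc.mp t.2).1) b)

/-- Open-loop trajectory: `x_s = x`, `x_{t+1} = f_t(x_t, u_t)` for `t ≥ s`. -/
def traj {X U : Type*} (f : ℕ → X → U → X) (u : ℕ → U) (s : ℕ) (x : X) (t : ℕ) : X :=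
  Nat.rec (motive := fun _ => X) x (fun k xk => f (s + k) xk (u (s + k))) (t - s)

/-- Closed-loop trajectory under feedback policy `γ`:
`x_s = x`, `x_{t+1} = f_t(x_t, γ_t(x_t))` for `t ≥ s`. -/
def ctraj {X U : Type*} (f : ℕ → X → U → X) (γ : ℕ → X → U) (s : ℕ) (x : X) (t : ℕ) : X :=
  Nat.rec (motive := fun _ => X) x (fun k xk => f (s + k) xk (γ (s + k) xk)) (t - s)

theorem raJ_le_iff (T : ℕ) (a b : ℕ → ℝ) (s : ℕ) (hs : s ≤ T) (c : ℝ) :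
    raJ T a b s hs ≤ c ↔ ∃ t, s ≤ t ∧ t ≤ T ∧ a t ≤ c ∧ ∀ τ, s ≤ τ → τ ≤ t → b τ ≤ c := by
  simp only [raJ, Finset.inf'_le_iff, Finset.mem_attach, true_and, Subtype.exists, max_le_iff,
    Finset.sup'_le_iff, Finset.mem_Icc, and_imp, exists_prop, and_assoc]

theorem raJ_congr (T : ℕ) {a b a' b' : ℕ → ℝ} (s : ℕ) (hs : s ≤ T)
    (ha : ∀ t, s ≤ t → a t = a' t) (hb : ∀ t, s ≤ t → b t = b' t) :
    raJ T a b s hs = raJ T a' b' s hs := by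
  refine eq_of_forall_ge_iff fun c => ?_
  simp only [raJ_le_iff]
  refine exists_congr fun t => and_congr_right fun ht => ?_
  rw [ha t ht]
  refine and_congr_right fun _ => and_congr_right fun _ => forall_congr' fun τ => ?_
  exact imp_congr_right fun hτ => by rw [hb τ hτ]

theorem raJ_self (T : ℕ) (a b : ℕ → ℝ) : raJ T a b T le_rfl = max (a T) (b T) := by
  refine eq_of_forall_ge_iff fun c => ?_
  rw [raJ_le_iff, max_le_iff]
  constructor
  · rintro ⟨t, h1, h2, h3, h4⟩
    obtain rfl := le_antisymm h1 h2
    exact ⟨h3, h4 _ le_rfl le_rfl⟩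
  · rintro ⟨h1, h2⟩
    refine ⟨T, le_rfl, le_rfl, h1, fun τ h3 h4 => ?_⟩
    obtain rfl := le_antisymm h3 h4
    exact h2

/-- Bellman recursion for the reach-avoid objective along a fixed signal. -/
theorem raJ_eq_max_min (T : ℕ) (a b : ℕ → ℝ) (s : ℕ) (hs : s + 1 ≤ T) :
    raJ T a b s (Nat.le_of_succ_le hs) = max (b s) (min (a s) (raJ T a b (s + 1) hs)) := by
  refine eq_of_forall_ge_iff fun c => ?_
  rw [max_le_iff, min_le_iff, raJ_le_iff, raJ_le_iff]
  constructor
  · rintro ⟨t, h1, h2, h3, h4⟩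
    refine ⟨h4 s le_rfl h1, ?_⟩
    rcases h1.eq_or_lt with rfl | h
    · exact Or.inl h3
    · exact Or.inr ⟨t, h, h2, h3, fun τ h5 h6 => h4 τ (Nat.le_of_succ_le h5) h6⟩
  · rintro ⟨hb, ha | ⟨t, h1, h2, h3, h4⟩⟩
    · refine ⟨s, le_rfl, Nat.le_of_succ_le hs, ha, fun τ h5 h6 => ?_⟩
      obtain rfl := le_antisymm h5 h6
      exact hb
    · refine ⟨t, Nat.le_of_succ_le h1, h2, h3, fun τ h5 h6 => ?_⟩
      rcases h5.eq_or_lt with rfl | h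
      · exact hb
      · exact h4 τ h h6

theorem ctraj_self {X U : Type*} (f : ℕ → X → U → X) (γ : ℕ → X → U) (s : ℕ) (x : X) :
    ctraj f γ s x s = x := by
  simp [ctraj]

theorem ctraj_succ {X U : Type*} (f : ℕ → X → U → X) (γ : ℕ → X → U) {s t : ℕ} (x : X)
    (h : s ≤ t) :
    ctraj f γ s x (t + 1) = f t (ctraj f γ s x t) (γ t (ctraj f γ s x t)) := by
  obtain ⟨k, rfl⟩ := Nat.exists_eq_add_of_le h
  simp [ctraj, Nat.add_assoc]

theorem ctraj_eq_ctraj_succ_start {X U : Type*} (f : ℕ → X → U → X) (γ : ℕ → X → U)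
    (s : ℕ) (x : X) (t : ℕ) (h : s + 1 ≤ t) :
    ctraj f γ s x t = ctraj f γ (s + 1) (f s x (γ s x)) t := by
  induction t, h using Nat.le_induction with
  | base => rw [ctraj_succ f γ x le_rfl, ctraj_self, ctraj_self]
  | succ t h ih => rw [ctraj_succ f γ x (Nat.le_of_succ_le h), ctraj_succ f γ _ h, ih]

theorem traj_eq_ctraj {X U : Type*} (f : ℕ → X → U → X) (u : ℕ → U) :
    traj f u = ctraj f (fun t _ => u t) := rfl

/-- The reach-avoid objective of the closed-loop trajectory under `γ` from `x` at time `s`. -/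
noncomputable def closedLoopCost {X U : Type*} (f : ℕ → X → U → X) (ℓ g : ℕ → X → ℝ) (T : ℕ)
    (γ : ℕ → X → U) (s : ℕ) (hs : s ≤ T) (x : X) : ℝ :=
  raJ T (fun t => ℓ t (ctraj f γ s x t)) (fun t => g t (ctraj f γ s x t)) s hs

theorem closedLoopCost_self {X U : Type*} (f : ℕ → X → U → X) (ℓ g : ℕ → X → ℝ) (T : ℕ)
    (γ : ℕ → X → U) (x : X) :
    closedLoopCost f ℓ g T γ T le_rfl x = max (ℓ T x) (g T x) := by
  simp only [closedLoopCost, raJ_self, ctraj_self]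

theorem closedLoopCost_eq_max_min {X U : Type*} (f : ℕ → X → U → X) (ℓ g : ℕ → X → ℝ) (T : ℕ)
    (γ : ℕ → X → U) (s : ℕ) (hs : s + 1 ≤ T) (x : X) :
    closedLoopCost f ℓ g T γ s (Nat.le_of_succ_le hs) x =
      max (g s x) (min (ℓ s x) (closedLoopCost f ℓ g T γ (s + 1) hs (f s x (γ s x)))) := by
  rw [closedLoopCost, raJ_eq_max_min _ _ _ _ hs, ctraj_self, closedLoopCost,
    raJ_congr T (s + 1) hs (fun t ht => by rw [ctraj_eq_ctraj_succ_start f γ s x t ht])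
      (fun t ht => by rw [ctraj_eq_ctraj_succ_start f γ s x t ht])]

/-- The reach-avoid value function with `n` steps to go from time `s`. -/
noncomputable def raValue {X U : Type*} [Fintype U] [Nonempty U] (f : ℕ → X → U → X)
    (ℓ g : ℕ → X → ℝ) : ℕ → ℕ → X → ℝ
  | 0, s, x => max (ℓ s x) (g s x)
  | n + 1, s, x => max (g s x) (min (ℓ s x)
      (Finset.univ.inf' Finset.univ_nonempty fun u => raValue f ℓ g n (s + 1) (f s x u)))

theorem raValue_le_closedLoopCost {X U : Type*} [Fintype U] [Nonempty U] (f : ℕ → X → U → X)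
    (ℓ g : ℕ → X → ℝ) (T : ℕ) (γ : ℕ → X → U) (n s : ℕ) (hs : s ≤ T) (h : s + n = T) (x : X) :
    raValue f ℓ g n s x ≤ closedLoopCost f ℓ g T γ s hs x := by
  induction n generalizing s x with
  | zero =>
    obtain rfl : s = T := h
    rw [closedLoopCost_self, raValue]
  | succ n ih =>
    have hs' : s + 1 ≤ T := by omega
    rw [closedLoopCost_eq_max_min _ _ _ _ _ _ hs', raValue]
    exact max_le_max le_rfl (min_le_min le_rfl
      ((Finset.inf'_le _ (Finset.mem_univ (γ s x))).trans (ih (s + 1) hs' (by omega) _)))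

/-- A policy that is greedy with respect to the value function attains it. -/
theorem closedLoopCost_eq_raValue {X U : Type*} [Fintype U] [Nonempty U] (f : ℕ → X → U → X)
    (ℓ g : ℕ → X → ℝ) (T : ℕ) (γ : ℕ → X → U)
    (hγ : ∀ s x, Finset.univ.inf' Finset.univ_nonempty
      (fun u => raValue f ℓ g (T - (s + 1)) (s + 1) (f s x u)) =
        raValue f ℓ g (T - (s + 1)) (s + 1) (f s x (γ s x)))
    (n s : ℕ) (hs : s ≤ T) (h : s + n = T) (x : X) :
    closedLoopCost f ℓ g T γ s hs x = raValue f ℓ g n s x := by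
  induction n generalizing s x with
  | zero =>
    obtain rfl : s = T := h
    rw [closedLoopCost_self, raValue]
  | succ n ih =>
    have hs' : s + 1 ≤ T := by omega
    obtain rfl : n = T - (s + 1) := by omega
    rw [closedLoopCost_eq_max_min _ _ _ _ _ _ hs', raValue, hγ, ih (s + 1) hs' (by omega)]

/-- There exists a feedback policy that is strongly time-consistent for the
reach-avoid problem: starting from any intermediate time `s ≤ T` and any state
`xinit`, its closed-loop trajectory achieves a reach-avoid objective `J_s` no worse
than that of any alternative control sequence. -/
theorem exists_strongly_time_consistent_feedback_policy
    {X U : Type*} [Fintype U] [Nonempty U]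
    (f : ℕ → X → U → X) (ℓ g : ℕ → X → ℝ) (T : ℕ) :
    ∃ π : ℕ → X → U, ∀ s (hs : s ≤ T), ∀ xinit : X, ∀ u : ℕ → U,
      raJ T (fun t => ℓ t (ctraj f π s xinit t)) (fun t => g t (ctraj f π s xinit t)) s hs ≤
        raJ T (fun t => ℓ t (traj f u s xinit t)) (fun t => g t (traj f u s xinit t)) s hs := by
  have greedy : ∀ s x, ∃ v : U, Finset.univ.inf' Finset.univ_nonempty
      (fun u => raValue f ℓ g (T - (s + 1)) (s + 1) (f s x u)) =
        raValue f ℓ g (T - (s + 1)) (s + 1) (f s x v) := fun s x => by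
    obtain ⟨v, -, hv⟩ := Finset.exists_mem_eq_inf' (Finset.univ_nonempty (α := U))
      (fun u => raValue f ℓ g (T - (s + 1)) (s + 1) (f s x u))
    exact ⟨v, hv⟩
  choose π hπ using greedy
  refine ⟨π, fun s hs x u => ?_⟩
  rw [traj_eq_ctraj]
  exact (closedLoopCost_eq_raValue f ℓ g T π hπ (T - s) s hs (by omega) x).trans_le
    (raValue_le_closedLoopCost f ℓ g T (fun t _ => u t) (T - s) s hs (by omega) x)
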